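/- For every integer s ≥ 1, every ω > 0 and every t ≥ 0, the truncated expansion satisfies Y_s(0; ω) = y₀ and the exact defect identity (∂/∂t) Y_s(t; ω) − A Y_s(t; ω) − Σ_{m=1}^{M} a_m(t) e^{i κ_m ω t} = ω^{−s} Σ_{m=1}^{M} ( p'_{s,m}(t) − A p_{s,m}(t) ) e^{i κ_m ω t}; in particular the residual of Y_s in the differential equation is O(ω^{−s}) uniformly on compact time intervals. -/

import Mathlib

open MeasureTheory

/-- The oscillatory expansion coefficients `p_{r,m}`, `1 ≤ m ≤ M`, of the linear problem. -/
noncomputable def pOsc {d M : ℕ} (A : Matrix (Fin d) (Fin d) ℂ) (κ : Fin M → ℝ)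
    (a : Fin M → ℝ → Fin d → ℂ) (r : ℕ) (m : Fin M) (t : ℝ) : Fin d → ℂ :=
  (Complex.I * (κ m)) ^ (-(r : ℤ)) •
    ∑ ℓ ∈ Finset.range r, ((-1 : ℂ) ^ ℓ * ((r - 1).choose ℓ : ℂ)) •
      (A ^ (r - 1 - ℓ)).mulVec (iteratedDeriv ℓ (a m) t)

/-- The non-oscillatory expansion coefficients `p_{r,0}` of the linear problem. -/
noncomputable def pNonOsc {d M : ℕ} (A : Matrix (Fin d) (Fin d) ℂ) (κ : Fin M → ℝ)
    (a : Fin M → ℝ → Fin d → ℂ) (r : ℕ) (t : ℝ) : Fin d → ℂ :=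
  - (NormedSpace.exp (t • A)).mulVec
      (∑ m : Fin M, (Complex.I * (κ m)) ^ (-(r : ℤ)) •
        ∑ ℓ ∈ Finset.range r, ((-1 : ℂ) ^ ℓ * ((r - 1).choose ℓ : ℂ)) •
          (A ^ (r - 1 - ℓ)).mulVec (iteratedDeriv ℓ (a m) 0))

/-- The truncated asymptotic expansion `Y_s(t; ω)` of the linear problem. -/
noncomputable def truncExp {d M : ℕ} (A : Matrix (Fin d) (Fin d) ℂ) (κ : Fin M → ℝ)
    (a : Fin M → ℝ → Fin d → ℂ) (y₀ : Fin d → ℂ) (s : ℕ) (ω t : ℝ) : Fin d → ℂ :=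
  (NormedSpace.exp (t • A)).mulVec y₀ +
    ∑ r ∈ Finset.Icc 1 s, ((ω ^ (-(r : ℤ)) : ℝ) : ℂ) •
      (pNonOsc A κ a r t +
        ∑ m : Fin M, Complex.exp (Complex.I * (κ m) * ω * t) • pOsc A κ a r m t)

/-- The derivative of an oscillatory coefficient, computed termwise. -/
theorem hasDerivAt_pOsc {d M : ℕ} (A : Matrix (Fin d) (Fin d) ℂ) (κ : Fin M → ℝ)
    (a : Fin M → ℝ → Fin d → ℂ) (r : ℕ) (m : Fin M)
    (ha : ∀ n : ℕ, ContDiff ℝ (n : ℕ∞) (a m)) (t : ℝ) :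
    HasDerivAt (fun τ : ℝ => pOsc A κ a r m τ)
      ((Complex.I * (κ m)) ^ (-(r : ℤ)) •
        ∑ ℓ ∈ Finset.range r, ((-1 : ℂ) ^ ℓ * ((r - 1).choose ℓ : ℂ)) •
          (A ^ (r - 1 - ℓ)).mulVec (iteratedDeriv (ℓ + 1) (a m) t)) t := by
  unfold pOsc
  refine HasDerivAt.fun_const_smul _ (HasDerivAt.fun_sum fun ℓ _ =>
    HasDerivAt.fun_const_smul _ ?_)
  have hdiff : HasDerivAt (iteratedDeriv ℓ (a m)) (iteratedDeriv (ℓ + 1) (a m) t) t := by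
    rw [iteratedDeriv_succ]
    refine (((ha (ℓ + 1)).differentiable_iteratedDeriv ℓ ?_) t).hasDerivAt
    exact_mod_cast Nat.lt_succ_self ℓ
  exact ((((A ^ (r - 1 - ℓ)).mulVecLin.restrictScalars ℝ).toContinuousLinearMap).hasFDerivAt
    |>.comp_hasDerivAt t hdiff)

/-- The recursion satisfied by the alternating binomial sums
`∑ (-1) ^ ℓ * choose n ℓ • A ^ (n - ℓ) v ℓ`. -/
theorem alternating_binomial_sum_succ {d : ℕ} (A : Matrix (Fin d) (Fin d) ℂ)
    (v : ℕ → Fin d → ℂ) (n : ℕ) :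
    ∑ ℓ ∈ Finset.range (n + 2), ((-1 : ℂ) ^ ℓ * ((n + 1).choose ℓ : ℂ)) •
        (A ^ (n + 1 - ℓ)).mulVec (v ℓ) =
      A.mulVec (∑ ℓ ∈ Finset.range (n + 1), ((-1 : ℂ) ^ ℓ * (n.choose ℓ : ℂ)) •
        (A ^ (n - ℓ)).mulVec (v ℓ)) -
      ∑ ℓ ∈ Finset.range (n + 1), ((-1 : ℂ) ^ ℓ * (n.choose ℓ : ℂ)) •
        (A ^ (n - ℓ)).mulVec (v (ℓ + 1)) := by
  have hA : A.mulVec (∑ ℓ ∈ Finset.range (n + 1), ((-1 : ℂ) ^ ℓ * (n.choose ℓ : ℂ)) •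
        (A ^ (n - ℓ)).mulVec (v ℓ)) =
      ∑ ℓ ∈ Finset.range (n + 2), ((-1 : ℂ) ^ ℓ * (n.choose ℓ : ℂ)) •
        (A ^ (n + 1 - ℓ)).mulVec (v ℓ) := by
    rw [Finset.sum_range_succ _ (n + 1), Nat.choose_succ_self, Matrix.mulVec_sum]
    simp only [Nat.cast_zero, mul_zero, zero_smul, add_zero]
    refine Finset.sum_congr rfl fun ℓ hℓ => ?_
    rw [Matrix.mulVec_smul, Matrix.mulVec_mulVec, ← pow_succ',
      Nat.succ_sub (Nat.lt_succ_iff.mp (Finset.mem_range.mp hℓ))]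
  rw [hA, Finset.sum_range_succ' _ (n + 1), Finset.sum_range_succ' _ (n + 1),
    add_sub_right_comm, ← Finset.sum_sub_distrib]
  simp only [Nat.choose_zero_right]
  congr 1
  refine Finset.sum_congr rfl fun ℓ _ => ?_
  rw [Nat.choose_succ_succ, Nat.add_sub_add_right, ← sub_smul]
  congr 1
  push_cast
  ring

theorem smul_pOsc_one {d M : ℕ} (A : Matrix (Fin d) (Fin d) ℂ) (κ : Fin M → ℝ)
    (a : Fin M → ℝ → Fin d → ℂ) (m : Fin M) (hκ : κ m ≠ 0) (t : ℝ) :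
    (Complex.I * (κ m)) • pOsc A κ a 1 m t = a m t := by
  have hne : Complex.I * (κ m : ℂ) ≠ 0 := by simp [hκ]
  simp [pOsc, smul_smul, -mul_inv_rev, mul_inv_cancel₀ hne]

/-- The recursion `i κ p_{r+1} = A p_r - p_r'` for the oscillatory coefficients. -/
theorem smul_pOsc_succ {d M : ℕ} (A : Matrix (Fin d) (Fin d) ℂ) (κ : Fin M → ℝ)
    (a : Fin M → ℝ → Fin d → ℂ) (r : ℕ) (hr : 1 ≤ r) (m : Fin M) (hκ : κ m ≠ 0)
    (ha : ∀ n : ℕ, ContDiff ℝ (n : ℕ∞) (a m)) (t : ℝ) :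
    (Complex.I * (κ m)) • pOsc A κ a (r + 1) m t =
      A.mulVec (pOsc A κ a r m t) - deriv (fun τ : ℝ => pOsc A κ a r m τ) t := by
  obtain ⟨n, rfl⟩ := Nat.exists_eq_add_of_le' hr
  have hne : Complex.I * (κ m : ℂ) ≠ 0 := by simp [hκ]
  rw [(hasDerivAt_pOsc A κ a (n + 1) m ha t).deriv]
  unfold pOsc
  simp only [Nat.add_sub_cancel]
  rw [Matrix.mulVec_smul, ← smul_sub,
    ← alternating_binomial_sum_succ A (fun ℓ => iteratedDeriv ℓ (a m) t) n, smul_smul,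
    ← zpow_one_add₀ hne]
  congr 2

section

attribute [local instance] Matrix.linftyOpNormedRing Matrix.linftyOpNormedAlgebra

theorem hasDerivAt_exp_smul_mulVec {d : ℕ} (A : Matrix (Fin d) (Fin d) ℂ) (v : Fin d → ℂ)
    (t : ℝ) :
    HasDerivAt (fun τ : ℝ => (NormedSpace.exp (τ • A)).mulVec v)
      (A.mulVec ((NormedSpace.exp (t • A)).mulVec v)) t := by
  have hexp := hasDerivAt_exp_smul_const' (𝕂 := ℝ) A t
  have h := ((((Matrix.mulVecBilin ℝ ℝ).flip v :
    Matrix (Fin d) (Fin d) ℂ →ₗ[ℝ] Fin d → ℂ).toContinuousLinearMap).hasFDerivAt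
    |>.comp_hasDerivAt t hexp)
  rw [Matrix.mulVec_mulVec]
  exact h

end

theorem pNonOsc_eq {d M : ℕ} (A : Matrix (Fin d) (Fin d) ℂ) (κ : Fin M → ℝ)
    (a : Fin M → ℝ → Fin d → ℂ) (r : ℕ) (t : ℝ) :
    pNonOsc A κ a r t =
      (NormedSpace.exp (t • A)).mulVec (-∑ m : Fin M, pOsc A κ a r m 0) := by
  simp only [pNonOsc, pOsc, Matrix.mulVec_neg]

theorem hasDerivAt_pNonOsc {d M : ℕ} (A : Matrix (Fin d) (Fin d) ℂ) (κ : Fin M → ℝ)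
    (a : Fin M → ℝ → Fin d → ℂ) (r : ℕ) (t : ℝ) :
    HasDerivAt (fun τ : ℝ => pNonOsc A κ a r τ) (A.mulVec (pNonOsc A κ a r t)) t := by
  simp only [pNonOsc_eq]
  exact hasDerivAt_exp_smul_mulVec A _ t

theorem truncExp_zero {d M : ℕ} (A : Matrix (Fin d) (Fin d) ℂ) (κ : Fin M → ℝ)
    (a : Fin M → ℝ → Fin d → ℂ) (y₀ : Fin d → ℂ) (s : ℕ) (ω : ℝ) :
    truncExp A κ a y₀ s ω 0 = y₀ := by
  simp [truncExp, pNonOsc_eq]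

theorem hasDerivAt_truncExp {d M : ℕ} (A : Matrix (Fin d) (Fin d) ℂ) (κ : Fin M → ℝ)
    (a : Fin M → ℝ → Fin d → ℂ) (ha : ∀ m, ∀ n : ℕ, ContDiff ℝ (n : ℕ∞) (a m))
    (y₀ : Fin d → ℂ) (s : ℕ) (ω t : ℝ) :
    HasDerivAt (fun τ : ℝ => truncExp A κ a y₀ s ω τ)
      (A.mulVec ((NormedSpace.exp (t • A)).mulVec y₀) +
        ∑ r ∈ Finset.Icc 1 s, ((ω ^ (-(r : ℤ)) : ℝ) : ℂ) •
          (A.mulVec (pNonOsc A κ a r t) +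
            ∑ m : Fin M, Complex.exp (Complex.I * (κ m) * ω * t) •
              (deriv (fun τ : ℝ => pOsc A κ a r m τ) t +
                (ω : ℂ) • (Complex.I * (κ m)) • pOsc A κ a r m t))) t := by
  unfold truncExp
  refine (hasDerivAt_exp_smul_mulVec A y₀ t).fun_add (HasDerivAt.fun_sum fun r _ =>
    HasDerivAt.fun_const_smul _ ((hasDerivAt_pNonOsc A κ a r t).fun_add
      (HasDerivAt.fun_sum fun m _ => ?_)))
  have hphase : HasDerivAt (fun τ : ℝ => Complex.exp (Complex.I * (κ m) * ω * τ))
      (Complex.exp (Complex.I * (κ m) * ω * t) * (Complex.I * (κ m) * ω * 1)) t :=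
    ((hasDerivAt_id t).ofReal_comp.const_mul _).cexp
  have hp := (hasDerivAt_pOsc A κ a r m (ha m) t).differentiableAt.hasDerivAt
  convert hphase.fun_smul hp using 1
  rw [smul_add, smul_smul, smul_smul]
  congr 2
  ring

/-- The contributions of the successive powers of `ω` telescope. -/
theorem sum_residual_eq {d M : ℕ} (A : Matrix (Fin d) (Fin d) ℂ) (κ : Fin M → ℝ)
    (hκ : ∀ m, κ m ≠ 0) (a : Fin M → ℝ → Fin d → ℂ)
    (ha : ∀ m, ∀ n : ℕ, ContDiff ℝ (n : ℕ∞) (a m)) (s : ℕ) (hs : 1 ≤ s) (ω : ℝ) (hω : ω ≠ 0)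
    (t : ℝ) (m : Fin M) :
    ∑ r ∈ Finset.Icc 1 s, ((ω ^ (-(r : ℤ)) : ℝ) : ℂ) •
        (deriv (fun τ : ℝ => pOsc A κ a r m τ) t - A.mulVec (pOsc A κ a r m t) +
          (ω : ℂ) • (Complex.I * (κ m)) • pOsc A κ a r m t) =
      a m t + ((ω ^ (-(s : ℤ)) : ℝ) : ℂ) •
        (deriv (fun τ : ℝ => pOsc A κ a s m τ) t - A.mulVec (pOsc A κ a s m t)) := by
  have hω' : (ω : ℂ) ≠ 0 := by exact_mod_cast hω
  induction s, hs using Nat.le_induction with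
  | base =>
    rw [Finset.Icc_self, Finset.sum_singleton, smul_pOsc_one A κ a m (hκ m) t, smul_add,
      smul_smul, add_comm]
    congr 1
    simp [hω']
  | succ s hs ih =>
    rw [Finset.sum_Icc_succ_top (Nat.le_add_left 1 s), ih,
      smul_pOsc_succ A κ a s hs m (hκ m) (ha m) t, smul_add _ _ ((ω : ℂ) • _), smul_smul]
    have hpow : ((ω ^ (-((s + 1 : ℕ) : ℤ)) : ℝ) : ℂ) * ω = ((ω ^ (-(s : ℤ)) : ℝ) : ℂ) := by
      rw [← Complex.ofReal_mul, ← zpow_add_one₀ hω]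
      congr 2
      push_cast
      ring
    rw [hpow]
    module

/-- The truncated expansion satisfies `Y_s(0; ω) = y₀` and the exact defect identity:
its residual in the linear ODE is `ω^{-s} Σₘ (p'_{s,m} − A p_{s,m}) e^{i κₘ ω t}`. -/
theorem truncExp_defect {d M : ℕ} (hd : 1 ≤ d) (hM : 1 ≤ M)
    (A : Matrix (Fin d) (Fin d) ℂ)
    (κ : Fin M → ℝ) (hκ : ∀ m, κ m ≠ 0)
    (a : Fin M → ℝ → Fin d → ℂ) (ha : ∀ m, ∀ n : ℕ, ContDiff ℝ (n : ℕ∞) (a m))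
    (y₀ : Fin d → ℂ) (s : ℕ) (hs : 1 ≤ s) (ω : ℝ) (hω : 0 < ω) :
    truncExp A κ a y₀ s ω 0 = y₀ ∧
    ∀ t : ℝ, 0 ≤ t →
      HasDerivAt (fun τ : ℝ => truncExp A κ a y₀ s ω τ)
        (A.mulVec (truncExp A κ a y₀ s ω t) +
          (∑ m : Fin M, Complex.exp (Complex.I * (κ m) * ω * t) • a m t) +
          ((ω ^ (-(s : ℤ)) : ℝ) : ℂ) •
            ∑ m : Fin M, Complex.exp (Complex.I * (κ m) * ω * t) •
              (deriv (fun τ : ℝ => pOsc A κ a s m τ) t - A.mulVec (pOsc A κ a s m t))) t := by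
  refine ⟨truncExp_zero A κ a y₀ s ω, fun t _ => ?_⟩
  convert hasDerivAt_truncExp A κ a ha y₀ s ω t using 1
  rw [Finset.smul_sum, add_assoc, ← Finset.sum_add_distrib]
  simp only [smul_comm _ (Complex.exp _), ← smul_add,
    ← sum_residual_eq A κ hκ a ha s hs ω hω.ne' t]
  rw [truncExp, Matrix.mulVec_add, Matrix.mulVec_sum, add_assoc]
  congr 1
  simp only [Finset.smul_sum]
  rw [Finset.sum_comm, ← Finset.sum_add_distrib]
  refine Finset.sum_congr rfl fun r _ => ?_
  rw [Matrix.mulVec_smul, Matrix.mulVec_add, Matrix.mulVec_sum, smul_add, smul_add, add_assoc,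
    Finset.smul_sum, Finset.smul_sum, ← Finset.sum_add_distrib]
  congr 1
  refine Finset.sum_congr rfl fun m _ => ?_
  rw [Matrix.mulVec_smul]
  module
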